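/- arXiv:1312.6560 — 2 statements merged into one kernel-verified Lean document; each statement's English description precedes it below -/
import Mathlib

section
/- Let A be an abelian category, K, Y objects, and L ⊆ Ext¹(Y, K) a finitely generated Γ(K)-submodule. A short exact sequence ξ₁ : 0 → K₁ → X₁ →^{α₁} Y → 0 is a universal L-extension if and only if it is a semi-universal L-extension (i.e. K₁ ∈ add K and Im c(ξ₁, K) = L) and α₁ is right minimal. -/
set_option linter.unusedSectionVars false

open CategoryTheory Abelian Limits

universe w v u

attribute [local instance] CategoryTheory.Abelian.hasFiniteBiproducts

variable {A : Type u} [Category.{v} A] [Abelian A]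

/-- `M` belongs to `add K`: it is a direct summand of a finite direct sum of copies of `K`. -/
def InAdd (K M : A) : Prop :=
  ∃ (n : ℕ) (s : M ⟶ ⨁ (fun _ : Fin n => K)) (r : (⨁ fun _ : Fin n => K) ⟶ M),
    s ≫ r = 𝟙 M

/-- `α` factors through `α'`. -/
def Factors {X X' Y : A} (α : X ⟶ Y) (α' : X' ⟶ Y) : Prop :=
  ∃ v : X ⟶ X', v ≫ α' = α

/-- `α` and `α'` are right equivalent. -/
def RightEquiv {X X' Y : A} (α : X ⟶ Y) (α' : X' ⟶ Y) : Prop :=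
  Factors α α' ∧ Factors α' α

/-- A morphism is right minimal. -/
def RightMinimal {X Y : A} (α : X ⟶ Y) : Prop :=
  ∀ v : X ⟶ X, v ≫ α = α → IsIso v

/-- A short exact sequence `0 → K → X → Y → 0`. -/
structure SES (K Y : A) where
  X : A
  i : K ⟶ X
  p : X ⟶ Y
  zero : i ≫ p = 0
  shortExact : (ShortComplex.mk i p zero).ShortExact

variable [HasExt.{w} A]

lemma Ext.mk₀_add' {X Y : A} (f g : X ⟶ Y) :
    Ext.mk₀ (f + g) = Ext.mk₀ f + Ext.mk₀ g := by
  letI := HasDerivedCategory.standard A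
  apply Ext.ext
  simp [Ext.add_hom, ShiftedHom.mk₀, Functor.map_add]

/-- The class `[ξ] ∈ Ext¹(Y, K)` of a short exact sequence `ξ`. -/
noncomputable def SES.cls {K Y : A} (E : SES K Y) : Ext Y K 1 :=
  E.shortExact.extClass

/-- The class `[u.ξ]` of the pushout of `ξ` along `u`. -/
noncomputable def SES.push {K Y Z : A} (E : SES K Y) (u : K ⟶ Z) : Ext Y Z 1 :=
  E.cls.comp (Ext.mk₀ u) (add_zero 1)

noncomputable instance extSMulEnd (Y K : A) : SMul (End K) (Ext Y K 1) :=
  ⟨fun g e => e.comp (Ext.mk₀ g) (add_zero 1)⟩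

lemma extSmul_def {Y K : A} (g : End K) (e : Ext Y K 1) :
    g • e = e.comp (Ext.mk₀ g) (add_zero 1) := rfl

/-- `Ext¹(Y, K)` as a left module over `Γ(K) = End K`, via pushout. -/
noncomputable instance extModuleEnd (Y K : A) : Module (End K) (Ext Y K 1) where
  one_smul e := by rw [extSmul_def]; exact Ext.comp_mk₀_id e
  mul_smul g h e := by
    rw [extSmul_def, extSmul_def, extSmul_def,
      Ext.comp_assoc_of_third_deg_zero, Ext.mk₀_comp_mk₀]
    rfl
  smul_add g e f := by
    rw [extSmul_def, extSmul_def, extSmul_def]; exact Ext.add_comp e f _ _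
  add_smul g h e := by
    rw [extSmul_def, extSmul_def, extSmul_def, Ext.mk₀_add', Ext.comp_add]
  zero_smul e := by rw [extSmul_def]; rw [Ext.mk₀_zero, Ext.comp_zero]
  smul_zero g := by rw [extSmul_def]; exact Ext.zero_comp _ _ _ _ _

/-- The connecting map `c(ξ, K) : Hom(K₁, K) → Ext¹(Y, K)`, `u ↦ [u.ξ]`,
as a morphism of left `Γ(K) = End K`-modules. -/
noncomputable def SES.conn {K₁ Y : A} (E : SES K₁ Y) (K : A) :
    (K₁ ⟶ K) →ₗ[End K] Ext Y K 1 where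
  toFun u := E.push u
  map_add' u v := by
    dsimp [SES.push]
    rw [Ext.mk₀_add', Ext.comp_add]
  map_smul' g u := by
    dsimp [SES.push]
    rw [End.smul_right, extSmul_def, Ext.comp_assoc_of_third_deg_zero,
      Ext.mk₀_comp_mk₀]

/-- Right minimality for a morphism of modules. -/
def ModRightMinimal {R : Type*} [Ring R] {M N : Type*} [AddCommGroup M] [AddCommGroup N]
    [Module R M] [Module R N] (c : M →ₗ[R] N) : Prop :=
  ∀ g : M →ₗ[R] M, c.comp g = c → Function.Bijective g

universe w'

/-- The `R`-module `M` admits a projective cover. -/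
def HasProjCover (R : Type*) [Ring R] (M : Type w') [AddCommGroup M] [Module R M] : Prop :=
  ∃ (P : Type w') (_ : AddCommGroup P) (_ : Module R P) (f : P →ₗ[R] M),
    Module.Projective R P ∧ Function.Surjective f ∧ ModRightMinimal f

/-- `ξ` is a universal `L`-extension of `Y` by `K`. -/
def IsUniversalExt (K : A) {K₁ Y : A} (E : SES K₁ Y) (L : Submodule (End K) (Ext Y K 1)) :
    Prop :=
  InAdd K K₁ ∧ LinearMap.range (E.conn K) = L ∧ ModRightMinimal (E.conn K)

lemma InAdd.self (K : A) : InAdd K K := by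
  refine ⟨1, biproduct.ι (fun _ : Fin 1 => K) (0 : Fin 1), biproduct.π (fun _ : Fin 1 => K) 0, ?_⟩
  simp

/-- A morphism out of the kernel extends to the middle term exactly when the pushout of the
extension along it has trivial class. -/
lemma SES.push_eq_zero_iff {K₁ Y Z : A} (E : SES K₁ Y) (d : K₁ ⟶ Z) :
    E.push d = 0 ↔ ∃ t : E.X ⟶ Z, E.i ≫ t = d := by
  constructor
  · intro h
    obtain ⟨x, hx⟩ := Ext.contravariant_sequence_exact₁ E.shortExact Z (Ext.mk₀ d) (add_zero 1) h
    obtain ⟨t, rfl⟩ := (Ext.mk₀_bijective _ _).2 x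
    refine ⟨t, (Ext.mk₀_bijective _ _).1 ?_⟩
    rw [← Ext.mk₀_comp_mk₀]
    exact hx
  · rintro ⟨t, rfl⟩
    have h : E.cls.comp (Ext.mk₀ E.i) (add_zero 1) = 0 := E.shortExact.extClass_comp
    rw [SES.push, ← Ext.mk₀_comp_mk₀, ← Ext.comp_assoc_of_third_deg_zero, h, Ext.zero_comp]

lemma SES.push_add {K₁ Y Z : A} (E : SES K₁ Y) (f g : K₁ ⟶ Z) :
    E.push (f + g) = E.push f + E.push g := by
  rw [SES.push, Ext.mk₀_add', Ext.comp_add]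
  rfl

lemma SES.push_comp {K₁ Y Z W : A} (E : SES K₁ Y) (f : K₁ ⟶ Z) (g : Z ⟶ W) :
    E.push (f ≫ g) = (E.push f).comp (Ext.mk₀ g) (add_zero 1) := by
  rw [SES.push, SES.push, ← Ext.mk₀_comp_mk₀, Ext.comp_assoc_of_third_deg_zero]

/-- An object of `add K` carries a finite dual basis of morphisms to and from `K`. -/
lemma InAdd.exists_dualBasis {K M : A} (h : InAdd K M) :
    ∃ (n : ℕ) (a : Fin n → (M ⟶ K)) (b : Fin n → (K ⟶ M)), ∑ j, a j ≫ b j = 𝟙 M := by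
  obtain ⟨n, s, r, hsr⟩ := h
  refine ⟨n, fun j => s ≫ biproduct.π _ j, fun j => biproduct.ι (fun _ : Fin n => K) j ≫ r, ?_⟩
  calc ∑ j, (s ≫ biproduct.π _ j) ≫ biproduct.ι (fun _ : Fin n => K) j ≫ r
      = s ≫ (∑ j, biproduct.π _ j ≫ biproduct.ι (fun _ : Fin n => K) j) ≫ r := by
        simp only [Preadditive.sum_comp, Preadditive.comp_sum, Category.assoc]
    _ = 𝟙 M := by rw [biproduct.total, Category.id_comp, hsr]

/-- Morphisms into an object of `add K` are determined by their composites with morphisms to `K`. -/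
lemma InAdd.hom_ext {K M X : A} (h : InAdd K M) {f g : X ⟶ M}
    (hfg : ∀ w : M ⟶ K, f ≫ w = g ≫ w) : f = g := by
  obtain ⟨n, a, b, hab⟩ := h.exists_dualBasis
  rw [← Category.comp_id f, ← Category.comp_id g, ← hab]
  simp only [Preadditive.comp_sum, ← Category.assoc, hfg]

/-- Extension classes with values in an object of `add K` are detected by morphisms to `K`. -/
lemma InAdd.ext_eq_zero {K M Y : A} (h : InAdd K M) (e : Ext Y M 1)
    (he : ∀ w : M ⟶ K, e.comp (Ext.mk₀ w) (add_zero 1) = 0) : e = 0 := by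
  obtain ⟨n, a, b, hab⟩ := h.exists_dualBasis
  let φ : (M ⟶ M) →+ Ext Y M 1 :=
    { toFun := fun f => e.comp (Ext.mk₀ f) (add_zero 1)
      map_zero' := by simp
      map_add' := fun f g => by rw [Ext.mk₀_add', Ext.comp_add] }
  have h1 : φ (𝟙 M) = e := Ext.comp_mk₀_id e
  rw [← h1, ← hab, map_sum]
  refine Finset.sum_eq_zero fun j _ => ?_
  change e.comp (Ext.mk₀ (a j ≫ b j)) (add_zero 1) = 0
  rw [← Ext.mk₀_comp_mk₀, ← Ext.comp_assoc_of_third_deg_zero, he, Ext.zero_comp]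

/-- Precomposition with `u`, as an endomorphism of the left `End K`-module `Hom(M, K)`. -/
def precompEnd (K : A) {M : A} (u : M ⟶ M) : (M ⟶ K) →ₗ[End K] (M ⟶ K) where
  toFun w := u ≫ w
  map_add' _ _ := Preadditive.comp_add _ _ _ _ _ _
  map_smul' g w := by simp [End.smul_right]

/-- Every endomorphism of the `End K`-module `Hom(M, K)` with `M ∈ add K` is precomposition
with an endomorphism of `M`. -/
lemma InAdd.exists_eq_precompEnd {K M : A} (h : InAdd K M)
    (g : (M ⟶ K) →ₗ[End K] (M ⟶ K)) : ∃ u : M ⟶ M, g = precompEnd K u := by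
  obtain ⟨n, a, b, hab⟩ := h.exists_dualBasis
  refine ⟨∑ j, g (a j) ≫ b j, LinearMap.ext fun w => ?_⟩
  change g w = (∑ j, g (a j) ≫ b j) ≫ w
  have hw : w = ∑ j, (End.of (b j ≫ w) : End K) • a j := by
    conv_lhs => rw [← Category.id_comp w, ← hab]
    simp only [Preadditive.sum_comp, Category.assoc]
    rfl
  conv_lhs => rw [hw]
  rw [map_sum, Preadditive.sum_comp]
  refine Finset.sum_congr rfl fun j _ => ?_
  rw [map_smul, Category.assoc]
  rfl

lemma InAdd.bijective_precompEnd_iff {K M : A} (h : InAdd K M) (u : M ⟶ M) :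
    Function.Bijective (precompEnd K u) ↔ IsIso u := by
  constructor
  · rintro ⟨hinj, hsurj⟩
    obtain ⟨n, a, b, hab⟩ := h.exists_dualBasis
    choose c hc using fun j => hsurj (a j)
    have hc' : ∀ j, u ≫ c j = a j := hc
    have huq : u ≫ ∑ j, c j ≫ b j = 𝟙 M := by
      rw [← hab, Preadditive.comp_sum]
      simp only [← Category.assoc, hc']
    refine ⟨∑ j, c j ≫ b j, huq, h.hom_ext fun w => hinj ?_⟩
    change u ≫ ((∑ j, c j ≫ b j) ≫ u) ≫ w = u ≫ 𝟙 M ≫ w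
    rw [Category.assoc, ← Category.assoc u, huq, Category.id_comp, Category.id_comp]
  · intro hu
    refine ⟨fun f g hfg => (cancel_epi u).1 hfg, fun f => ⟨inv u ≫ f, ?_⟩⟩
    exact IsIso.hom_inv_id_assoc u f

/-- If `𝟙 + f ≫ g` is invertible, so is `𝟙 + g ≫ f`. -/
lemma isIso_id_add_comp_swap {C : Type*} [Category C] [Preadditive C] {X Z : C}
    (f : X ⟶ Z) (g : Z ⟶ X) (h : IsIso (𝟙 X + f ≫ g)) : IsIso (𝟙 Z + g ≫ f) := by
  obtain ⟨w, hw₁, hw₂⟩ := h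
  have h₁ : f ≫ g ≫ w = 𝟙 X - w := by
    rw [eq_sub_iff_add_eq, add_comm]
    simpa using hw₁
  have h₂ : w ≫ f ≫ g = 𝟙 X - w := by
    rw [eq_sub_iff_add_eq, add_comm]
    simpa using hw₂
  have h₁' : f ≫ g ≫ w ≫ f = f - w ≫ f := by
    simpa using congrArg (fun k => k ≫ f) h₁
  have h₂' : w ≫ f ≫ g ≫ f = f - w ≫ f := by
    simpa using congrArg (fun k => k ≫ f) h₂
  refine ⟨𝟙 Z - g ≫ w ≫ f, ?_, ?_⟩
  · simp [h₁']
  · simp [h₂']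

lemma SES.rightMinimal_iff {K₁ Y : A} (E : SES K₁ Y) :
    RightMinimal E.p ↔ ∀ t : E.X ⟶ K₁, IsIso (𝟙 K₁ + E.i ≫ t) := by
  constructor
  · intro h t
    exact isIso_id_add_comp_swap t E.i (h _ (by simp [E.zero]))
  · intro h v hv
    have := E.shortExact.mono_f
    obtain ⟨t, ht⟩ : ∃ t : E.X ⟶ K₁, t ≫ E.i = v - 𝟙 E.X :=
      ⟨E.shortExact.exact.lift (v - 𝟙 E.X) (by simp [hv]), E.shortExact.exact.lift_f _ _⟩
    have hvt : v = 𝟙 E.X + t ≫ E.i := by rw [ht]; abel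
    rw [hvt]
    exact isIso_id_add_comp_swap E.i t (h t)

lemma SES.conn_comp_precompEnd_eq_iff {K K₁ Y : A} (E : SES K₁ Y) (h : InAdd K K₁)
    (u : K₁ ⟶ K₁) :
    (E.conn K).comp (precompEnd K u) = E.conn K ↔
      ∃ t : E.X ⟶ K₁, 𝟙 K₁ + E.i ≫ t = u := by
  have key : ∀ w : K₁ ⟶ K, E.push (u ≫ w) =
      (E.push (u - 𝟙 K₁)).comp (Ext.mk₀ w) (add_zero 1) + E.push w := fun w => by
    rw [← E.push_comp, ← E.push_add]
    simp
  have hpush : (E.conn K).comp (precompEnd K u) = E.conn K ↔ E.push (u - 𝟙 K₁) = 0 := by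
    constructor
    · intro hc
      refine h.ext_eq_zero _ fun w => ?_
      have hw : E.push (u ≫ w) = E.push w := LinearMap.congr_fun hc w
      rwa [key, add_eq_right] at hw
    · intro h0
      refine LinearMap.ext fun w => ?_
      change E.push (u ≫ w) = E.push w
      rw [key, h0, Ext.zero_comp, zero_add]
  rw [hpush, E.push_eq_zero_iff]
  simp only [eq_sub_iff_add_eq']

/-- If `K₁ ∈ add K`, the connecting map of an extension by `K₁` is right minimal exactly when
its deflation is. -/
lemma SES.modRightMinimal_conn_iff {K K₁ Y : A} (E : SES K₁ Y) (h : InAdd K K₁) :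
    ModRightMinimal (E.conn K) ↔ RightMinimal E.p := by
  rw [E.rightMinimal_iff]
  constructor
  · intro hm t
    exact (h.bijective_precompEnd_iff _).1
      (hm _ ((E.conn_comp_precompEnd_eq_iff h _).2 ⟨t, rfl⟩))
  · intro hm g hg
    obtain ⟨u, rfl⟩ := h.exists_eq_precompEnd g
    obtain ⟨t, rfl⟩ := (E.conn_comp_precompEnd_eq_iff h u).1 hg
    exact (h.bijective_precompEnd_iff _).2 (hm t)

/-- `ξ₁` is a universal `L`-extension iff it is a semi-universal
`L`-extension and `α₁` is right minimal. -/
theorem stmt11 {K K₁ Y : A} (E₁ : SES K₁ Y) (L : Submodule (End K) (Ext Y K 1))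
    (hL : L.FG) :
    IsUniversalExt K E₁ L ↔
      ((InAdd K K₁ ∧ LinearMap.range (E₁.conn K) = L) ∧ RightMinimal E₁.p) := by
  constructor
  · rintro ⟨h, hr, hm⟩
    exact ⟨⟨h, hr⟩, (E₁.modRightMinimal_conn_iff h).1 hm⟩
  · rintro ⟨⟨h, hr⟩, hm⟩
    exact ⟨h, hr, (E₁.modRightMinimal_conn_iff h).2 hm⟩
end

section
/- Let A be an abelian category. A morphism α : X → Y is projectively trivial (i.e. Ext¹(α, −) = 0, equivalently [ξ.α] = 0 for every object Z and every class [ξ] ∈ Ext¹(Y, Z)) if and only if α factors through every epimorphism ending at Y. -/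
set_option linter.unusedSectionVars false

open CategoryTheory Abelian Limits

universe w v u

attribute [local instance] CategoryTheory.Abelian.hasFiniteBiproducts

variable {A : Type u} [Category.{v} A] [Abelian A]

variable [HasExt.{w} A]

universe w'

/-- A quasi-isomorphism in degree `i` from a complex concentrated in degrees `≤ i` to a single
complex in degree `i` admits, after refinement along an epimorphism, a section. -/
lemma CochainComplex.exists_epi_single_map_lift {C : Type u} [Category.{v} C] [Abelian C]
    {Y : C} {K : CochainComplex C ℤ} {i : ℤ}
    (π : K ⟶ (HomologicalComplex.single C (ComplexShape.up ℤ) i).obj Y)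
    [K.IsStrictlyLE i] [QuasiIsoAt π i] :
    ∃ (P : C) (g : P ⟶ Y) (_ : Epi g)
      (σ : (HomologicalComplex.single C (ComplexShape.up ℤ) i).obj P ⟶ K),
      σ ≫ π = (HomologicalComplex.single C (ComplexShape.up ℤ) i).map g := by
  have hK : ∀ k, (ComplexShape.up ℤ).Rel i k → IsZero (K.X k) := by
    rintro _ rfl
    exact K.isZero_of_isStrictlyLE i (i + 1) (by simp)
  let e := K.iCyclesIso i (i + 1) (by simp) ((hK (i + 1) (by simp)).eq_of_tgt _ _)
  let α := e.inv ≫ K.homologyπ i ≫ HomologicalComplex.homologyMap π i ≫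
    (HomologicalComplex.singleObjHomologySelfIso _ _ _).hom
  have hα : π.f i = α ≫ (HomologicalComplex.singleObjXSelf (ComplexShape.up ℤ) i Y).inv := by
    rw [← cancel_epi e.hom]
    dsimp only [α, e]
    rw [Category.assoc, Category.assoc, Category.assoc,
      Iso.hom_inv_id_assoc,
      HomologicalComplex.homologyπ_naturality_assoc,
      HomologicalComplex.homologyπ_singleObjHomologySelfIso_hom_assoc,
      ← HomologicalComplex.singleObjCyclesSelfIso_inv_iCycles, Iso.hom_inv_id_assoc,
      HomologicalComplex.cyclesMap_i, HomologicalComplex.iCyclesIso_hom]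
  refine ⟨K.X i, α, inferInstance, HomologicalComplex.mkHomFromSingle (𝟙 _)
    fun k hk ↦ (hK k hk).eq_of_tgt _ _, ?_⟩
  apply HomologicalComplex.from_single_hom_ext
  rw [HomologicalComplex.comp_f, HomologicalComplex.mkHomFromSingle_f, Category.assoc, hα,
    Category.id_comp, HomologicalComplex.single_map_f_self]

/-- A morphism in the derived category from an object in degree `i` to a complex concentrated
in degrees `< i` vanishes after precomposition with an epimorphism. -/
lemma DerivedCategory.exists_epi_single_map_comp_eq_zero {C : Type u} [Category.{v} C]
    [Abelian C] [HasDerivedCategory.{w} C] {Y : C} {L : CochainComplex C ℤ} {i : ℤ}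
    (φ : Q.obj ((HomologicalComplex.single C (ComplexShape.up ℤ) i).obj Y) ⟶ Q.obj L)
    (n : ℤ) (hn : n < i) [L.IsStrictlyLE n] :
    ∃ (P : C) (g : P ⟶ Y) (_ : Epi g),
      Q.map ((HomologicalComplex.single C (ComplexShape.up ℤ) i).map g) ≫ φ = 0 := by
  obtain ⟨K, _, π, h, f, rfl⟩ := right_fac_of_isStrictlyLE φ i
  have : QuasiIso π := by rwa [isIso_Q_map_iff_quasiIso] at h
  obtain ⟨P, g, hg, σ, hσ⟩ := CochainComplex.exists_epi_single_map_lift π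
  refine ⟨P, g, hg, ?_⟩
  have h₀ : σ ≫ f = 0 := by
    apply HomologicalComplex.from_single_hom_ext
    apply (L.isZero_of_isStrictlyLE n i hn).eq_of_tgt
  rw [← hσ, Q.map_comp, Category.assoc, IsIso.hom_inv_id_assoc, ← Q.map_comp, h₀, Q.map_zero]

/-- `Ext` in positive degrees is effaceable in the first variable. -/
lemma Ext.exists_epi_mk₀_comp_eq_zero {Y Z : A} {n : ℕ} (e : Ext Y Z (n + 1)) :
    ∃ (P : A) (g : P ⟶ Y) (_ : Epi g), (Ext.mk₀ g).comp e (zero_add (n + 1)) = 0 := by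
  let := HasDerivedCategory.standard A
  let s := ((DerivedCategory.singleFunctors A).shiftIso (n + 1) (-(n + 1)) 0
    (by lia)).hom.app Z
  obtain ⟨P, g, hg, h⟩ := DerivedCategory.exists_epi_single_map_comp_eq_zero
    (L := (HomologicalComplex.single A (ComplexShape.up ℤ) (-(n + 1))).obj Z) (i := 0) (e.hom ≫ s) (-(n + 1))
    (by lia)
  refine ⟨P, g, hg, ?_⟩
  ext
  rw [Ext.comp_hom, Ext.mk₀_hom, ShiftedHom.mk₀_comp, Ext.zero_hom, ← cancel_mono s,
    Limits.zero_comp, Category.assoc]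
  exact h

/-- A morphism to `Y` lifts along an epimorphism if it annihilates all first extensions of `Y`. -/
lemma Ext.exists_lift_of_mk₀_comp_eq_zero {X Y : A} (α : X ⟶ Y)
    (hα : ∀ (Z : A) (e : Ext Y Z 1), (Ext.mk₀ α).comp e (zero_add 1) = 0)
    {W : A} (g : W ⟶ Y) [Epi g] : ∃ h : X ⟶ W, h ≫ g = α := by
  let S := ShortComplex.mk _ _ (kernel.condition g)
  have hS : S.ShortExact :=
    { exact := ShortComplex.exact_of_f_is_kernel _ (kernelIsKernel g) }
  obtain ⟨x, hx⟩ := Ext.covariant_sequence_exact₃ X hS (Ext.mk₀ α) (zero_add 1) (hα _ _)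
  obtain ⟨h, rfl⟩ := (Ext.mk₀_bijective X W).2 x
  refine ⟨h, (Ext.mk₀_bijective X Y).1 ?_⟩
  rwa [← Ext.mk₀_comp_mk₀]

/-- `α : X ⟶ Y` is projectively trivial (`Ext¹(α, −) = 0`, i.e. every
class of `Ext¹(Y, Z)` pulls back to zero along `α`) iff `α` factors through every
epimorphism ending at `Y`. -/
theorem stmt15 {X Y : A} (α : X ⟶ Y) :
    (∀ (Z : A) (e : Ext Y Z 1), (Ext.mk₀ α).comp e (zero_add 1) = 0) ↔
      ∀ (W : A) (g : W ⟶ Y), Epi g → ∃ h : X ⟶ W, h ≫ g = α := by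
  refine ⟨fun hα W g _ ↦ Ext.exists_lift_of_mk₀_comp_eq_zero α hα g, fun hα Z e ↦ ?_⟩
  obtain ⟨P, g, hg, hge⟩ := Ext.exists_epi_mk₀_comp_eq_zero e
  obtain ⟨h, rfl⟩ := hα P g hg
  rw [← Ext.mk₀_comp_mk₀_assoc, hge, Ext.comp_zero]
end
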